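/- Let n ≥ 4, let s ≥ 1 with n + s even, let 0 ≤ r ≤ n, let Γ = {(t₁, t₂, 0, …, 0) : t₁, t₂ ∈ 𝔽₂} be a 2-dimensional coordinate face of 𝔽₂ⁿ, and let f : 𝔽₂ⁿ → 𝔽₂ be an s-plateaued function. Then there exist an invertible affine transformation A : 𝔽₂ⁿ → 𝔽₂ⁿ and an affine function ℓ : 𝔽₂ⁿ → 𝔽₂ such that g = (f ∘ A) ⊕ ℓ is s-plateaued and satisfies: (a) the number of y ∈ 𝔽₂ⁿ for which g takes the value 0 an odd number of times on the coset Γ ⊕ y is less than 2^{n−1} if s > 1, and less than 2^{n−1} + 1 if s = 1; and (b) among the y in the Hamming ball B_{n,r} = {y ∈ 𝔽₂ⁿ : wt(y) ≤ r} for which g takes the value 0 an even number of times on Γ ⊕ y, at least one fourth are such that g takes the value 0 exactly four times or zero times on Γ ⊕ y. -/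

import Mathlib

/-- Inner product on 𝔽₂ⁿ. -/
def ip {n : ℕ} (x y : Fin n → ZMod 2) : ZMod 2 := ∑ i, x i * y i

/-- Walsh–Hadamard transform of a Boolean function. -/
def walsh {n : ℕ} (f : (Fin n → ZMod 2) → ZMod 2) (y : Fin n → ZMod 2) : ℤ :=
  ∑ x, (-1 : ℤ) ^ (f x + ip x y).val

/-- `f` is `s`-plateaued: all Walsh coefficients lie in `{0, ±2^((n+s)/2)}`. -/
def IsPlateaued {n : ℕ} (s : ℕ) (f : (Fin n → ZMod 2) → ZMod 2) : Prop :=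
  ∀ y, walsh f y = 0 ∨ walsh f y = 2 ^ ((n + s) / 2) ∨ walsh f y = -2 ^ ((n + s) / 2)

/-- Hamming weight of a vector in 𝔽₂ⁿ. -/
def wt {n : ℕ} (y : Fin n → ZMod 2) : ℕ := ∑ i, (y i).val

/-- The number of zero values of `g` on the coset `Γ ⊕ y` of the 2-dimensional
coordinate face `Γ = {(t₁,t₂,0,…,0)}`, i.e. on the four points agreeing with `y`
in all coordinates except possibly the first two. -/
def faceZeros {n : ℕ} (g : (Fin n → ZMod 2) → ZMod 2) (y : Fin n → ZMod 2) : ℕ :=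
  (Finset.univ.filter (fun v : Fin n → ZMod 2 =>
    (∀ i : Fin n, 2 ≤ (i : ℕ) → v i = y i) ∧ g v = 0)).card

/-- The sign `(-1)^z` attached to a bit `z`. -/
def bitSign (z : ZMod 2) : ℤ := (-1) ^ z.val

theorem bitSign_add (a b : ZMod 2) : bitSign (a + b) = bitSign a * bitSign b := by
  unfold bitSign
  decide +revert

theorem bitSign_mul_self (a : ZMod 2) : bitSign a * bitSign a = 1 := by
  unfold bitSign
  decide +revert

section Fourier

variable {n : ℕ}

theorem ip_add_left (x x' y : Fin n → ZMod 2) : ip (x + x') y = ip x y + ip x' y := by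
  simp [ip, add_mul, Finset.sum_add_distrib]

theorem ip_add_right (x y y' : Fin n → ZMod 2) : ip x (y + y') = ip x y + ip x y' := by
  simp [ip, mul_add, Finset.sum_add_distrib]

theorem ip_comm (x y : Fin n → ZMod 2) : ip x y = ip y x := by
  simp [ip, mul_comm]

theorem ip_single (x : Fin n → ZMod 2) (i : Fin n) : ip x (Pi.single i 1) = x i := by
  simp [ip, Pi.single_apply]

theorem add_self_eq_zero_vec (x : Fin n → ZMod 2) : x + x = 0 := by
  ext i
  exact CharTwo.add_self_eq_zero _

theorem add_eq_zero_iff_eq_vec (x y : Fin n → ZMod 2) : x + y = 0 ↔ x = y := by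
  constructor
  · intro h
    calc x = x + (y + y) := by rw [add_self_eq_zero_vec, add_zero]
      _ = x + y + y := by rw [add_assoc]
      _ = y := by rw [h, zero_add]
  · rintro rfl
    exact add_self_eq_zero_vec x

theorem card_vec : Fintype.card (Fin n → ZMod 2) = 2 ^ n := by
  simp [ZMod.card]

theorem sum_bitSign_ip (u : Fin n → ZMod 2) :
    ∑ y, bitSign (ip u y) = if u = 0 then 2 ^ n else 0 := by
  split_ifs with h
  · subst h
    simp [ip, bitSign, ZMod.card]
  · obtain ⟨i, hi⟩ : ∃ i, u i ≠ 0 := by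
      by_contra! h'
      exact h (funext h')
    have hi1 : u i = 1 := by
      generalize u i = z at hi ⊢
      decide +revert
    have hsum : ∑ y, bitSign (ip u y) = ∑ y, -bitSign (ip u y) := by
      rw [← Equiv.sum_comp (Equiv.addRight (Pi.single i 1 : Fin n → ZMod 2))]
      refine Finset.sum_congr rfl fun y _ => ?_
      rw [Equiv.coe_addRight, ip_add_right, ip_single, hi1, bitSign_add]
      simp [bitSign, ZMod.val_one]
    rw [Finset.sum_neg_distrib] at hsum
    omega

theorem parseval (h : (Fin n → ZMod 2) → ℤ) :
    ∑ y, (∑ x, h x * bitSign (ip x y)) ^ 2 = 2 ^ n * ∑ x, h x ^ 2 := by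
  calc ∑ y, (∑ x, h x * bitSign (ip x y)) ^ 2
      = ∑ y, ∑ x, ∑ x', h x * h x' * bitSign (ip (x + x') y) := by
        refine Finset.sum_congr rfl fun y _ => ?_
        rw [sq, Finset.sum_mul_sum]
        refine Finset.sum_congr rfl fun x _ => Finset.sum_congr rfl fun x' _ => ?_
        rw [ip_add_left, bitSign_add]
        ring
    _ = ∑ x, ∑ x', h x * h x' * ∑ y, bitSign (ip (x + x') y) := by
        rw [Finset.sum_comm]
        refine Finset.sum_congr rfl fun x _ => ?_
        rw [Finset.sum_comm]
        simp only [Finset.mul_sum]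
    _ = 2 ^ n * ∑ x, h x ^ 2 := by
        rw [Finset.mul_sum]
        refine Finset.sum_congr rfl fun x _ => ?_
        simp only [sum_bitSign_ip, add_eq_zero_iff_eq_vec, mul_ite, mul_zero,
          Finset.sum_ite_eq, Finset.mem_univ, if_true]
        ring

theorem walsh_eq (f : (Fin n → ZMod 2) → ZMod 2) (y : Fin n → ZMod 2) :
    walsh f y = ∑ x, bitSign (f x) * bitSign (ip x y) := by
  simp only [← bitSign_add]
  rfl

theorem sum_walsh_sq (f : (Fin n → ZMod 2) → ZMod 2) :
    ∑ y, walsh f y ^ 2 = 2 ^ n * 2 ^ n := by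
  simp only [walsh_eq, parseval, sq (bitSign _), bitSign_mul_self]
  simp [ZMod.card]

/-- The autocorrelation of `(-1)^f` at the shift `u`. -/
def autocorr (f : (Fin n → ZMod 2) → ZMod 2) (u : Fin n → ZMod 2) : ℤ :=
  ∑ x, bitSign (f x + f (x + u))

/-- The sum of `(-1)^(D_u D_v f)`, where `D_u D_v f` is the second derivative of `f` in the
directions `u` and `v`. -/
def secondDerivSum (f : (Fin n → ZMod 2) → ZMod 2) (u v : Fin n → ZMod 2) : ℤ :=
  ∑ x, bitSign (f x + f (x + u) + f (x + v) + f (x + u + v))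

theorem walsh_sq (f : (Fin n → ZMod 2) → ZMod 2) (y : Fin n → ZMod 2) :
    walsh f y ^ 2 = ∑ u, autocorr f u * bitSign (ip u y) := by
  rw [walsh_eq, sq, Finset.sum_mul_sum]
  simp only [autocorr, Finset.sum_mul]
  rw [Finset.sum_comm (s := Finset.univ) (t := Finset.univ)
    (f := fun u x => bitSign (f x + f (x + u)) * bitSign (ip u y))]
  refine Finset.sum_congr rfl fun x _ => ?_
  rw [← Equiv.sum_comp (Equiv.addLeft x)]
  refine Finset.sum_congr rfl fun u _ => ?_
  rw [Equiv.coe_addLeft, ip_add_left, bitSign_add, bitSign_add]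
  linear_combination
    (bitSign (f x) * bitSign (f (x + u)) * bitSign (ip u y)) * bitSign_mul_self (ip x y)

theorem autocorr_sq (f : (Fin n → ZMod 2) → ZMod 2) (u : Fin n → ZMod 2) :
    autocorr f u ^ 2 = ∑ v, secondDerivSum f u v := by
  simp only [autocorr, secondDerivSum]
  rw [sq, Finset.sum_mul_sum, Finset.sum_comm (s := Finset.univ) (t := Finset.univ)
    (f := fun v x => bitSign (f x + f (x + u) + f (x + v) + f (x + u + v)))]
  refine Finset.sum_congr rfl fun x _ => ?_
  rw [← Equiv.sum_comp (Equiv.addLeft x)]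
  refine Finset.sum_congr rfl fun v _ => ?_
  rw [Equiv.coe_addLeft, ← bitSign_add, add_right_comm x v u, ← add_assoc]

theorem sum_walsh_pow_four (f : (Fin n → ZMod 2) → ZMod 2) :
    ∑ y, walsh f y ^ 4 = 2 ^ n * ∑ u, ∑ v, secondDerivSum f u v := by
  simp only [← autocorr_sq]
  rw [← parseval]
  refine Finset.sum_congr rfl fun y _ => ?_
  rw [← walsh_sq, ← pow_mul]

theorem IsPlateaued.sum_secondDerivSum {f : (Fin n → ZMod 2) → ZMod 2} {s : ℕ}
    (hf : IsPlateaued s f) (hpar : (n + s) % 2 = 0) :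
    ∑ u, ∑ v, secondDerivSum f u v = 2 ^ s * (2 ^ n * 2 ^ n) := by
  have hexp : ((2 : ℤ) ^ ((n + s) / 2)) ^ 2 = 2 ^ n * 2 ^ s := by
    rw [← pow_mul, ← pow_add]
    congr 1
    omega
  have hpt : ∀ y, walsh f y ^ 4 = 2 ^ n * 2 ^ s * walsh f y ^ 2 := by
    intro y
    rw [← hexp]
    rcases hf y with h | h | h <;> rw [h] <;> ring
  have h4 := sum_walsh_pow_four f
  simp only [hpt] at h4
  rw [← Finset.mul_sum, sum_walsh_sq] at h4
  have hpos : (2 : ℤ) ^ n ≠ 0 := by positivity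
  exact (mul_left_cancel₀ hpos (by linear_combination h4)).symm

theorem secondDerivSum_le (f : (Fin n → ZMod 2) → ZMod 2) (u v : Fin n → ZMod 2) :
    secondDerivSum f u v ≤ 2 ^ n := by
  have hle : ∀ z : ZMod 2, bitSign z ≤ 1 := by
    unfold bitSign
    decide
  calc secondDerivSum f u v ≤ ∑ _x : Fin n → ZMod 2, (1 : ℤ) :=
        Finset.sum_le_sum fun x _ => hle _
    _ = 2 ^ n := by simp [ZMod.card]

/-- The directions `u`, `v` fail to be linearly independent in only `O(2^n)` cases, so some
independent pair reaches the threshold `1 - k` as soon as the total sum is large enough. -/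
theorem exists_pair_lt_secondDerivSum (f : (Fin n → ZMod 2) → ZMod 2) (k : ℤ) (hk : 0 ≤ k)
    (hsum : 3 * 2 ^ n * (2 ^ n + k) - k * (2 ^ n * 2 ^ n) <
      ∑ u, ∑ v, secondDerivSum f u v) :
    ∃ u v : Fin n → ZMod 2, u ≠ 0 ∧ v ≠ 0 ∧ u ≠ v ∧ -k < secondDerivSum f u v := by
  by_contra! h
  refine hsum.not_ge ?_
  have hpt : ∀ u v, secondDerivSum f u v ≤
      ((if u = 0 then 2 ^ n + k else 0) + (if v = 0 then 2 ^ n + k else 0) +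
        (if u = v then 2 ^ n + k else 0)) - k := by
    intro u v
    have h1 := secondDerivSum_le f u v
    have h2 : (0 : ℤ) < 2 ^ n := by positivity
    have h3 := h u v
    by_cases hu : u = 0
    · rw [if_pos hu]
      split_ifs <;> linarith
    by_cases hv : v = 0
    · rw [if_neg hu, if_pos hv]
      split_ifs <;> linarith
    by_cases huv : u = v
    · rw [if_neg hu, if_neg hv, if_pos huv]
      linarith
    · rw [if_neg hu, if_neg hv, if_neg huv]
      linarith [h3 hu hv huv]
  calc ∑ u, ∑ v, secondDerivSum f u v
      ≤ ∑ u : Fin n → ZMod 2, ∑ v : Fin n → ZMod 2,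
        (((if u = 0 then 2 ^ n + k else 0) + (if v = 0 then 2 ^ n + k else 0) +
        (if u = v then 2 ^ n + k else 0)) - k) :=
        Finset.sum_le_sum fun u _ => Finset.sum_le_sum fun v _ => hpt u v
    _ = 3 * 2 ^ n * (2 ^ n + k) - k * (2 ^ n * 2 ^ n) := by
        simp only [Finset.sum_sub_distrib, Finset.sum_add_distrib, Finset.sum_const,
          Finset.sum_ite_eq, Finset.sum_ite_eq', Finset.mem_univ, if_true, Finset.card_univ,
          card_vec, nsmul_eq_mul, ← Finset.mul_sum]
        push_cast
        ring

theorem secondDerivSum_eq_card (f : (Fin n → ZMod 2) → ZMod 2) (u v : Fin n → ZMod 2) :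
    secondDerivSum f u v = 2 ^ n - 2 * ((Finset.univ.filter fun x =>
      f x + f (x + u) + f (x + v) + f (x + u + v) = 1).card : ℤ) := by
  have hz : ∀ z : ZMod 2, bitSign z = 1 - 2 * (if z = 1 then 1 else 0) := by
    unfold bitSign
    decide
  simp only [secondDerivSum, hz, Finset.sum_sub_distrib, ← Finset.mul_sum, Finset.sum_boole]
  simp [ZMod.card]

end Fourier

section Affine

variable {n : ℕ}

theorem exists_linearEquiv_pair {K V : Type*} [Field K] [AddCommGroup V] [Module K V]
    [FiniteDimensional K V] {x y u v : V} (hxy : LinearIndependent K ![x, y])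
    (huv : LinearIndependent K ![u, v]) : ∃ L : V ≃ₗ[K] V, L x = u ∧ L y = v := by
  have h0 {a b : V} (h : LinearIndependent K ![a, b]) :
      (h.linearCombinationEquiv (Finsupp.single 0 1) : V) = a := by simp
  have h1 {a b : V} (h : LinearIndependent K ![a, b]) :
      (h.linearCombinationEquiv (Finsupp.single 1 1) : V) = b := by simp
  obtain ⟨g, hg⟩ := Submodule.exists_linearEquiv_restrict_eq
    (hxy.linearCombinationEquiv.symm ≪≫ₗ huv.linearCombinationEquiv)
  refine ⟨g, ?_, ?_⟩
  · calc g x = g (hxy.linearCombinationEquiv (Finsupp.single 0 1)) := by rw [h0 hxy]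
      _ = u := by rw [← hg, LinearEquiv.trans_apply, LinearEquiv.symm_apply_apply, h0 huv]
  · calc g y = g (hxy.linearCombinationEquiv (Finsupp.single 1 1)) := by rw [h1 hxy]
      _ = v := by rw [← hg, LinearEquiv.trans_apply, LinearEquiv.symm_apply_apply, h1 huv]

theorem linearIndependent_pair_zmod_two {u v : Fin n → ZMod 2} (hu : u ≠ 0) (hv : v ≠ 0)
    (huv : u ≠ v) : LinearIndependent (ZMod 2) ![u, v] := by
  rw [LinearIndependent.pair_iff]
  have hbit : ∀ z : ZMod 2, z = 0 ∨ z = 1 := by decide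
  intro a b hab
  rcases hbit a with rfl | rfl <;> rcases hbit b with rfl | rfl <;>
    simp_all [add_eq_zero_iff_eq_vec]

theorem ip_linearMap (M : (Fin n → ZMod 2) →ₗ[ZMod 2] (Fin n → ZMod 2))
    (z y : Fin n → ZMod 2) : ip (M z) y = ip z fun i => ip (M (Pi.single i 1)) y := by
  conv_lhs => rw [LinearMap.pi_apply_eq_sum_univ M z]
  simp only [ip, Finset.sum_apply, Pi.smul_apply, smul_eq_mul, Finset.sum_mul, Finset.mul_sum]
  rw [Finset.sum_comm]
  refine Finset.sum_congr rfl fun i _ => Finset.sum_congr rfl fun j _ => ?_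
  have hsingle : (fun k => if i = k then 1 else 0) = (Pi.single i 1 : Fin n → ZMod 2) := by
    ext k
    simp [Pi.single_apply, eq_comm]
  rw [mul_assoc, hsingle]

theorem IsPlateaued.comp_add {s : ℕ} {f : (Fin n → ZMod 2) → ZMod 2} (hf : IsPlateaued s f)
    (L : (Fin n → ZMod 2) ≃ₗ[ZMod 2] (Fin n → ZMod 2)) (a : Fin n → ZMod 2) :
    IsPlateaued s fun x => f (L x) + ip a x := by
  intro y
  have hw : walsh (fun x => f (L x) + ip a x) y =
      walsh f fun i => ip (L.symm (Pi.single i 1)) (a + y) := by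
    simp only [walsh]
    rw [← Equiv.sum_comp L.symm.toEquiv]
    refine Finset.sum_congr rfl fun z _ => ?_
    have h := ip_linearMap (L.symm : (Fin n → ZMod 2) →ₗ[ZMod 2] (Fin n → ZMod 2)) z (a + y)
    simp only [LinearEquiv.coe_coe] at h
    simp only [LinearEquiv.coe_toEquiv, LinearEquiv.apply_symm_apply]
    rw [← h, ip_add_right, ip_comm a, add_assoc]
  rw [hw]
  exact hf _

theorem secondDerivSum_comp (f : (Fin n → ZMod 2) → ZMod 2)
    (L : (Fin n → ZMod 2) ≃ₗ[ZMod 2] (Fin n → ZMod 2)) (x y : Fin n → ZMod 2) :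
    secondDerivSum (fun z => f (L z)) x y = secondDerivSum f (L x) (L y) := by
  simp only [secondDerivSum, map_add]
  exact Equiv.sum_comp L.toEquiv fun z =>
    bitSign (f z + f (z + L x) + f (z + L y) + f (z + L x + L y))

theorem secondDeriv_add_ip (f : (Fin n → ZMod 2) → ZMod 2) (a u v x : Fin n → ZMod 2) :
    (f x + ip a x) + (f (x + u) + ip a (x + u)) + (f (x + v) + ip a (x + v)) +
      (f (x + u + v) + ip a (x + u + v)) = f x + f (x + u) + f (x + v) + f (x + u + v) := by
  simp only [ip_add_right]
  linear_combination (2 * ip a x + ip a u + ip a v) *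
    (CharTwo.two_eq_zero : (2 : ZMod 2) = 0)

end Affine

section Face

variable {n : ℕ}

theorem faceZeros_eq (g : (Fin n → ZMod 2) → ZMod 2) (y : Fin n → ZMod 2) {i j : Fin n}
    (hi : (i : ℕ) = 0) (hj : (j : ℕ) = 1) :
    faceZeros g y = (if g y = 0 then 1 else 0) + (if g (y + Pi.single i 1) = 0 then 1 else 0) +
      (if g (y + Pi.single j 1) = 0 then 1 else 0) +
      (if g (y + Pi.single i 1 + Pi.single j 1) = 0 then 1 else 0) := by
  have hij : i ≠ j := by
    rintro rfl
    omega
  have hface : (Finset.univ.filter fun v : Fin n → ZMod 2 =>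
      (∀ l : Fin n, 2 ≤ (l : ℕ) → v l = y l) ∧ g v = 0) =
      ({y, y + Pi.single i 1, y + Pi.single j 1, y + Pi.single i 1 + Pi.single j 1} :
        Finset (Fin n → ZMod 2)).filter fun v => g v = 0 := by
    ext v
    simp only [Finset.mem_filter, Finset.mem_univ, true_and, Finset.mem_insert,
      Finset.mem_singleton]
    refine and_congr_left fun _ => ⟨fun h => ?_, ?_⟩
    · have key : ∀ α β : ZMod 2, v i = y i + α → v j = y j + β →
          v = y + Pi.single i α + Pi.single j β := by
        intro α β hα hβ
        ext l
        by_cases hli : l = i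
        · subst hli
          simp [hα, hij]
        by_cases hlj : l = j
        · subst hlj
          simp [hβ, hij.symm]
        · have hl : 2 ≤ (l : ℕ) := by
            have h0 : (l : ℕ) ≠ i := fun h => hli (Fin.ext h)
            have h1 : (l : ℕ) ≠ j := fun h => hlj (Fin.ext h)
            omega
          simp [h l hl, hli, hlj]
      have hbit : ∀ p q : ZMod 2, p = q + 0 ∨ p = q + 1 := by decide
      rcases hbit (v i) (y i) with h0 | h0 <;> rcases hbit (v j) (y j) with h1 | h1 <;>
        have hv := key _ _ h0 h1 <;> (try simp only [Pi.single_zero, add_zero] at hv) <;> tauto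
    · have hne : ∀ l : Fin n, 2 ≤ (l : ℕ) → l ≠ i ∧ l ≠ j := by
        intro l hl
        constructor <;> rintro rfl <;> omega
      rintro (rfl | rfl | rfl | rfl) l hl <;> simp [(hne l hl).1, (hne l hl).2]
  have hsi : (Pi.single i 1 : Fin n → ZMod 2) ≠ 0 := by simp
  have hsj : (Pi.single j 1 : Fin n → ZMod 2) ≠ 0 := by simp
  have hsij : (Pi.single i 1 : Fin n → ZMod 2) ≠ Pi.single j 1 := by
    intro h
    simpa [hij] using congrFun h i
  have hsum : (Pi.single i 1 + Pi.single j 1 : Fin n → ZMod 2) ≠ 0 := by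
    rwa [Ne, add_eq_zero_iff_eq_vec]
  rw [faceZeros, hface, Finset.card_filter, Finset.sum_insert, Finset.sum_insert,
    Finset.sum_insert, Finset.sum_singleton]
  · ring
  · simp [hsi]
  · simp [add_assoc, hsij, hsj]
  · simp [add_assoc, hsi, hsj, hsum]

theorem odd_faceZeros_iff (g : (Fin n → ZMod 2) → ZMod 2) (y : Fin n → ZMod 2) {i j : Fin n}
    (hi : (i : ℕ) = 0) (hj : (j : ℕ) = 1) :
    Odd (faceZeros g y) ↔ g y + g (y + Pi.single i 1) + g (y + Pi.single j 1) +
      g (y + Pi.single i 1 + Pi.single j 1) = 1 := by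
  rw [faceZeros_eq g y hi hj]
  generalize g y = p, g (y + Pi.single i 1) = q, g (y + Pi.single j 1) = t,
    g (y + Pi.single i 1 + Pi.single j 1) = w
  decide +revert

theorem faceZeros_eq_zero_or_four (g : (Fin n → ZMod 2) → ZMod 2) (y : Fin n → ZMod 2)
    {i j : Fin n} (hi : (i : ℕ) = 0) (hj : (j : ℕ) = 1) (heven : Even (faceZeros g y))
    (h0 : g y + g (y + Pi.single i 1) = 0) (h1 : g y + g (y + Pi.single j 1) = 0) :
    faceZeros g y = 0 ∨ faceZeros g y = 4 := by
  rw [faceZeros_eq g y hi hj] at heven ⊢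
  generalize g y = p, g (y + Pi.single i 1) = q, g (y + Pi.single j 1) = t,
    g (y + Pi.single i 1 + Pi.single j 1) = w at *
  decide +revert

end Face

/-- Every `s`-plateaued function `f` (with `s ≥ 1`) has an EA-equivalent form
`g = (f ∘ A) ⊕ ℓ` (with `A : x ↦ L x + b` an invertible affine transformation and
`ℓ : x ↦ ⟨a,x⟩ ⊕ c` affine) such that: (a) the number of `y` whose face `Γ ⊕ y`
carries an odd number of zeros of `g` is `< 2^{n-1}` if `s > 1` and `< 2^{n-1} + 1`
if `s = 1`; (b) among the `y` in the Hamming ball of radius `r` whose face carries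
an even number of zeros of `g`, at least one fourth carry four or zero zeros. -/
theorem plateaued_good_representative (n s r : ℕ) (hn : 4 ≤ n) (hs : 1 ≤ s)
    (hpar : (n + s) % 2 = 0) (hr : r ≤ n)
    (f : (Fin n → ZMod 2) → ZMod 2) (hf : IsPlateaued s f) :
    ∃ g : (Fin n → ZMod 2) → ZMod 2,
      (∃ (L : (Fin n → ZMod 2) ≃ₗ[ZMod 2] (Fin n → ZMod 2))
         (b a : Fin n → ZMod 2) (c : ZMod 2),
        g = fun x => f (L x + b) + (ip a x + c)) ∧
      IsPlateaued s g ∧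
      (1 < s →
        (Finset.univ.filter (fun y : Fin n → ZMod 2 => Odd (faceZeros g y))).card
          < 2 ^ (n - 1)) ∧
      (s = 1 →
        (Finset.univ.filter (fun y : Fin n → ZMod 2 => Odd (faceZeros g y))).card
          < 2 ^ (n - 1) + 1) ∧
      (Finset.univ.filter (fun y : Fin n → ZMod 2 =>
          wt y ≤ r ∧ Even (faceZeros g y))).card ≤
        4 * (Finset.univ.filter (fun y : Fin n → ZMod 2 =>
          wt y ≤ r ∧ Even (faceZeros g y) ∧
            (faceZeros g y = 0 ∨ faceZeros g y = 4))).card := by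
  obtain ⟨i, hi⟩ : ∃ i : Fin n, (i : ℕ) = 0 := ⟨⟨0, by omega⟩, rfl⟩
  obtain ⟨j, hj⟩ : ∃ j : Fin n, (j : ℕ) = 1 := ⟨⟨1, by omega⟩, rfl⟩
  have hij : i ≠ j := by
    rintro rfl
    omega
  have htot := hf.sum_secondDerivSum hpar
  have hn16 : (16 : ℤ) ≤ 2 ^ n := by
    calc (16 : ℤ) = 2 ^ 4 := by norm_num
      _ ≤ 2 ^ n := pow_le_pow_right₀ (by norm_num) hn
  obtain ⟨u, v, hu, hv, huv, hlt⟩ : ∃ u v : Fin n → ZMod 2, u ≠ 0 ∧ v ≠ 0 ∧ u ≠ v ∧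
      -(if s = 1 then 2 else 0) < secondDerivSum f u v := by
    refine exists_pair_lt_secondDerivSum f _ (by split_ifs <;> norm_num) ?_
    rw [htot]
    split_ifs with h1
    · subst h1
      nlinarith
    · have hs4 : (4 : ℤ) ≤ 2 ^ s := by
        calc (4 : ℤ) = 2 ^ 2 := by norm_num
          _ ≤ 2 ^ s := pow_le_pow_right₀ (by norm_num) (by omega)
      nlinarith [mul_le_mul_of_nonneg_right hs4 (by positivity : (0 : ℤ) ≤ 2 ^ n * 2 ^ n)]
  have hsij : (Pi.single i 1 : Fin n → ZMod 2) ≠ Pi.single j 1 := by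
    intro h
    simpa [hij] using congrFun h i
  obtain ⟨L, hLi, hLj⟩ := exists_linearEquiv_pair
    (linearIndependent_pair_zmod_two (by simp) (by simp) hsij)
    (linearIndependent_pair_zmod_two hu hv huv)
  set F : (Fin n → ZMod 2) → ZMod 2 := fun x => f (L x) with hF
  have hodd : ∀ a y, Odd (faceZeros (fun x => F x + ip a x) y) ↔
      F y + F (y + Pi.single i 1) + F (y + Pi.single j 1) +
        F (y + Pi.single i 1 + Pi.single j 1) = 1 := by
    intro a y
    rw [odd_faceZeros_iff _ y hi hj, secondDeriv_add_ip]
  have hcard : ∀ a, -(if s = 1 then 2 else 0) < 2 ^ n - 2 * ((Finset.univ.filter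
      fun y => Odd (faceZeros (fun x => F x + ip a x) y)).card : ℤ) := by
    intro a
    simp only [hodd]
    rwa [← secondDerivSum_eq_card, hF, secondDerivSum_comp, hLi, hLj]
  have hpow : (2 : ℤ) ^ n = 2 * ((2 ^ (n - 1) : ℕ) : ℤ) := by
    push_cast
    rw [← pow_succ']
    congr 1
    omega
  obtain ⟨d, -, hd⟩ := Finset.exists_le_card_fiber_of_nsmul_le_card_of_maps_to
    (s := Finset.univ.filter fun y : Fin n → ZMod 2 =>
      wt y ≤ r ∧ Even (faceZeros (fun x => F x + ip 0 x) y))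
    (t := (Finset.univ : Finset (ZMod 2 × ZMod 2)))
    (f := fun y => (F y + F (y + Pi.single i 1), F y + F (y + Pi.single j 1)))
    (b := ((Finset.univ.filter fun y : Fin n → ZMod 2 =>
      wt y ≤ r ∧ Even (faceZeros (fun x => F x + ip 0 x) y)).card : ℚ) / 4)
    (fun _ _ => Finset.mem_univ _) Finset.univ_nonempty (by
      rw [nsmul_eq_mul, Finset.card_univ, Fintype.card_prod, ZMod.card]
      push_cast
      linarith)
  set a : Fin n → ZMod 2 := Pi.single i d.1 + Pi.single j d.2 with ha
  have hai : a i = d.1 := by simp [ha, hij]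
  have haj : a j = d.2 := by simp [ha, hij.symm]
  have heven : ∀ y, Even (faceZeros (fun x => F x + ip a x) y) ↔
      Even (faceZeros (fun x => F x + ip 0 x) y) := by
    intro y
    rw [← Nat.not_odd_iff_even, ← Nat.not_odd_iff_even, hodd, hodd]
  refine ⟨fun x => F x + ip a x, ⟨L, 0, a, 0, by simp [hF]⟩, hf.comp_add L a, ?_, ?_, ?_⟩
  · intro h1
    have h := hcard a
    rw [if_neg (by omega), hpow] at h
    omega
  · intro h1
    have h := hcard a
    rw [if_pos h1, hpow] at h
    omega
  · simp only [heven]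
    rw [div_le_iff₀ (by norm_num)] at hd
    rw [mul_comm] at hd
    refine (by exact_mod_cast hd : _ ≤ 4 * _).trans
      (Nat.mul_le_mul_left 4 (Finset.card_le_card fun y hy => ?_))
    simp only [Finset.mem_filter, Finset.mem_univ, true_and] at hy ⊢
    obtain ⟨⟨hwt, hev⟩, rfl⟩ := hy
    refine ⟨hwt, hev, faceZeros_eq_zero_or_four _ y hi hj ((heven y).mpr hev) ?_ ?_⟩
    · rw [ip_add_right, ip_single, hai]
      linear_combination (F y + F (y + Pi.single i 1) + ip a y) *
        (CharTwo.two_eq_zero : (2 : ZMod 2) = 0)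
    · rw [ip_add_right, ip_single, haj]
      linear_combination (F y + F (y + Pi.single j 1) + ip a y) *
        (CharTwo.two_eq_zero : (2 : ZMod 2) = 0)
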